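/- Suppose V̂ satisfies the Bellman equation for π. Then for every action a and every k with 1 ≤ k ≤ N−1: Var_π((p_k(a|s,S_k)/π(a|s))·δ_k | S_0 = s) = Σ_{s' : p_k(s'|s) > 0} (p_k(s'|s,a)/π(a|s))·p_k(a|s,s')·E_π[δ_k² | S_0 = s, S_k = s']. -/

import Mathlib

open Finset

attribute [local instance] Classical.propDecidable

namespace HCA

/-- A trajectory of horizon `N`: the actions taken at steps `0, …, N-1` and the
states reached after each step (the start state is fixed separately). -/
abbrev Traj (S A : Type*) (N : ℕ) : Type _ := (Fin N → A) × (Fin N → S)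

variable {S A : Type*} [Fintype S] [Fintype A] [Nonempty S] [Nonempty A]

/-- The state `S_k` of a trajectory with start state `s`. -/
def st {N : ℕ} (s : S) (τ : Traj S A N) : ℕ → S
  | 0 => s
  | k + 1 => if h : k < N then τ.2 ⟨k, h⟩ else s

/-- The action `A_k` of a trajectory. -/
noncomputable def ac {N : ℕ} (τ : Traj S A N) (k : ℕ) : A :=
  if h : k < N then τ.1 ⟨k, h⟩ else Classical.arbitrary A

/-- The probability `P_π(τ) = ∏_{k=0}^{N-1} π(A_k|S_k)·P(S_{k+1}|S_k,A_k)` of a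
trajectory starting at `s`. -/
noncomputable def trajP (π : S → A → ℝ) (P : S → A → S → ℝ) (s : S) (N : ℕ)
    (τ : Traj S A N) : ℝ :=
  ∏ k : Fin N, π (st s τ k) (τ.1 k) * P (st s τ k) (τ.1 k) (st s τ (k + 1))

/-- Expectation `E_π[f | S_0 = s]` over trajectories. -/
noncomputable def expct (π : S → A → ℝ) (P : S → A → S → ℝ) (s : S) (N : ℕ)
    (f : Traj S A N → ℝ) : ℝ :=
  ∑ τ : Traj S A N, trajP π P s N τ * f τ

/-- Variance `Var_π(f | S_0 = s)` over trajectories. -/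
noncomputable def vr (π : S → A → ℝ) (P : S → A → S → ℝ) (s : S) (N : ℕ)
    (f : Traj S A N → ℝ) : ℝ :=
  expct π P s N (fun τ => (f τ - expct π P s N f) ^ 2)

/-- Covariance `cov_π(f, g | S_0 = s)` over trajectories. -/
noncomputable def cv (π : S → A → ℝ) (P : S → A → S → ℝ) (s : S) (N : ℕ)
    (f g : Traj S A N → ℝ) : ℝ :=
  expct π P s N (fun τ => (f τ - expct π P s N f) * (g τ - expct π P s N g))

/-- Probability `P_π(E | S_0 = s)` of an event `E` on trajectories. -/
noncomputable def prE (π : S → A → ℝ) (P : S → A → S → ℝ) (s : S) (N : ℕ)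
    (E : Traj S A N → Prop) : ℝ :=
  ∑ τ : Traj S A N, if E τ then trajP π P s N τ else 0

/-- The TD error `δ_k = r(S_k,A_k) + γ·V̂(S_{k+1}) − V̂(S_k)`. -/
noncomputable def td (r : S → A → ℝ) (γ : ℝ) (V : S → ℝ) (s : S) {N : ℕ}
    (τ : Traj S A N) (k : ℕ) : ℝ :=
  r (st s τ k) (ac τ k) + γ * V (st s τ (k + 1)) - V (st s τ k)

/-- `p_k(s'|s,a) = P_π(S_k = s' | S_0 = s, A_0 = a)
  = P_π(A_0 = a, S_k = s' | S_0 = s) / π(a|s)`. -/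
noncomputable def pkSA (π : S → A → ℝ) (P : S → A → S → ℝ) (s : S) (N k : ℕ)
    (a : A) (s' : S) : ℝ :=
  prE π P s N (fun τ => ac τ 0 = a ∧ st s τ k = s') / π s a

/-- `p_k(s'|s) = Σ_a π(a|s)·p_k(s'|s,a)`. -/
noncomputable def pkS (π : S → A → ℝ) (P : S → A → S → ℝ) (s : S) (N k : ℕ)
    (s' : S) : ℝ :=
  ∑ a : A, π s a * pkSA π P s N k a s'

/-- The hindsight probability `p_k(a|s,s')`, defined as
`P_π(A_0 = a, S_k = s' | S_0 = s)/p_k(s'|s)` when `p_k(s'|s) > 0` and `0` otherwise. -/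
noncomputable def pkA (π : S → A → ℝ) (P : S → A → S → ℝ) (s : S) (N k : ℕ)
    (a : A) (s' : S) : ℝ :=
  if 0 < pkS π P s N k s' then
    prE π P s N (fun τ => ac τ 0 = a ∧ st s τ k = s') / pkS π P s N k s'
  else 0

/-- The `N`-step Monte-Carlo advantage estimator
`Â^MC_N(a) = (1(A_0=a)/π(a|s))·Σ_{k=0}^{N−1} γ^k·δ_k`. -/
noncomputable def mcEst (π : S → A → ℝ) (r : S → A → ℝ) (γ : ℝ) (V : S → ℝ)
    (s : S) (N : ℕ) (a : A) (τ : Traj S A N) : ℝ :=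
  ((if ac τ 0 = a then (1 : ℝ) else 0) / π s a) * ∑ k ∈ range N, γ ^ k * td r γ V s τ k

/-- The `N`-step δHCA advantage estimator
`Â^δHCA_N(a) = (1(A_0=a)/π(a|s))·δ_0 + Σ_{k=1}^{N−1} γ^k·(p_k(a|s,S_k)/π(a|s))·δ_k`. -/
noncomputable def dhcaEst (π : S → A → ℝ) (P : S → A → S → ℝ) (r : S → A → ℝ)
    (γ : ℝ) (V : S → ℝ) (s : S) (N : ℕ) (a : A) (τ : Traj S A N) : ℝ :=
  ((if ac τ 0 = a then (1 : ℝ) else 0) / π s a) * td r γ V s τ 0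
    + ∑ k ∈ Ico 1 N, γ ^ k * (pkA π P s N k a (st s τ k) / π s a) * td r γ V s τ k

/-- `V` satisfies the Bellman equation for `π`:
`V(s₀) = Σ_a π(a|s₀)·(r(s₀,a) + γ·Σ_{s'} P(s'|s₀,a)·V(s'))` for every state `s₀`. -/
def IsBellman (π : S → A → ℝ) (P : S → A → S → ℝ) (r : S → A → ℝ) (γ : ℝ)
    (V : S → ℝ) : Prop :=
  ∀ s₀ : S, V s₀ = ∑ a : A, π s₀ a * (r s₀ a + γ * ∑ s' : S, P s₀ a s' * V s')

/-- The conditional second moment `E_π[δ_k² | S_0 = s, S_k = s']`,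
defined as `(Σ_{τ : S_k = s'} P_π(τ)·δ_k(τ)²)/p_k(s'|s)`. -/
noncomputable def sndMom (π : S → A → ℝ) (P : S → A → S → ℝ) (r : S → A → ℝ)
    (γ : ℝ) (V : S → ℝ) (s : S) (N k : ℕ) (s' : S) : ℝ :=
  (∑ τ : Traj S A N, if st s τ k = s' then trajP π P s N τ * (td r γ V s τ k) ^ 2 else 0)
    / pkS π P s N k s'

/-- Prepend a first action and a first reached state to a trajectory. -/
def consT {N : ℕ} (a : A) (x : S) (τ : Traj S A N) : Traj S A (N + 1) :=
  (Fin.cons a τ.1, Fin.cons x τ.2)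

lemma st_consT {N : ℕ} (s x : S) (a : A) (τ : Traj S A N) (k : ℕ) (hk : k ≤ N) :
    st s (consT a x τ) (k + 1) = st x τ k := by
  cases k with
  | zero => simp [st, consT]
  | succ k =>
    have h : k < N := hk
    simp only [st, consT, h, Nat.succ_lt_succ_iff, dite_true]
    exact Fin.cons_succ (α := fun _ => S) x τ.2 ⟨k, h⟩

lemma ac_consT_succ {N : ℕ} (x : S) (a : A) (τ : Traj S A N) (k : ℕ) (hk : k < N) :
    ac (consT a x τ) (k + 1) = ac τ k := by
  simp only [ac, consT, hk, Nat.succ_lt_succ_iff, dite_true]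
  exact Fin.cons_succ (α := fun _ => A) a τ.1 ⟨k, hk⟩

lemma ac_consT_zero {N : ℕ} (x : S) (a : A) (τ : Traj S A N) :
    ac (consT a x τ) 0 = a := by
  simp [ac, consT]

lemma trajP_consT (π : S → A → ℝ) (P : S → A → S → ℝ) {N : ℕ} (s x : S) (a : A)
    (τ : Traj S A N) :
    trajP π P s (N + 1) (consT a x τ) = π s a * P s a x * trajP π P x N τ := by
  unfold trajP
  rw [Fin.prod_univ_succ]
  congr 1
  apply Finset.prod_congr rfl
  intro i _
  have h1 : st s (consT a x τ) ((i.succ : Fin (N + 1)) : ℕ) = st x τ i := by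
    rw [Fin.val_succ]; exact st_consT s x a τ i i.2.le
  have h2 : st s (consT a x τ) (((i.succ : Fin (N + 1)) : ℕ) + 1) = st x τ (i + 1) := by
    rw [Fin.val_succ]; exact st_consT s x a τ (i + 1) i.2
  have h3 : (consT a x τ).1 i.succ = τ.1 i := by simp [consT]
  rw [h1, h2, h3]

lemma expct_succ (π : S → A → ℝ) (P : S → A → S → ℝ) (s : S) (N : ℕ)
    (f : Traj S A (N + 1) → ℝ) :
    expct π P s (N + 1) f
      = ∑ a : A, ∑ x : S, π s a * P s a x * expct π P x N (fun τ => f (consT a x τ)) := by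
  unfold expct
  rw [Fintype.sum_prod_type]
  rw [← (Fin.consEquiv (fun _ => A)).sum_comp, Fintype.sum_prod_type]
  apply Finset.sum_congr rfl
  intro a _
  simp_rw [← (Fin.consEquiv (fun _ : Fin (N + 1) => S)).sum_comp, Fintype.sum_prod_type]
  rw [Finset.sum_comm]
  apply Finset.sum_congr rfl
  intro x _
  rw [Finset.mul_sum]
  refine Finset.sum_congr rfl fun u _ => ?_
  rw [Finset.mul_sum]
  refine Finset.sum_congr rfl fun v _ => ?_
  rw [← mul_assoc, ← trajP_consT]
  rfl

lemma expct_const (π : S → A → ℝ) (P : S → A → S → ℝ)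
    (hπsum : ∀ s₀ : S, ∑ a : A, π s₀ a = 1)
    (hPsum : ∀ (s₀ : S) (a : A), ∑ s' : S, P s₀ a s' = 1) (c : ℝ) (N : ℕ) (s : S) :
    expct π P s N (fun _ => c) = c := by
  induction N generalizing s with
  | zero => simp [expct, trajP]
  | succ N ih =>
    rw [expct_succ]
    simp_rw [ih, ← Finset.sum_mul, ← Finset.mul_sum, hPsum, mul_one, hπsum, one_mul]

lemma expct_td (π : S → A → ℝ) (P : S → A → S → ℝ) (r : S → A → ℝ) (γ : ℝ)
    (hπsum : ∀ s₀ : S, ∑ a : A, π s₀ a = 1)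
    (hPsum : ∀ (s₀ : S) (a : A), ∑ s' : S, P s₀ a s' = 1)
    (V : S → ℝ) (hV : IsBellman π P r γ V) (g : S → ℝ) (N : ℕ) (s : S) (k : ℕ) (hk : k < N) :
    expct π P s N (fun τ => g (st s τ k) * td r γ V s τ k) = 0 := by
  induction N generalizing s k with
  | zero => omega
  | succ N ih =>
    rw [expct_succ]
    cases k with
    | zero =>
      have h : ∀ (a : A) (x : S), (fun τ : Traj S A N => g (st s (consT a x τ) 0)
          * td r γ V s (consT a x τ) 0) = fun _ => g s * (r s a + γ * V x - V s) := by
        intro a x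
        funext τ
        have h1 := st_consT s x a τ 0 (Nat.zero_le _)
        simp only [td, ac_consT_zero, h1]
        rfl
      simp_rw [h, expct_const π P hπsum hPsum]
      have h2 : ∀ a : A, ∑ x : S, π s a * P s a x * (g s * (r s a + γ * V x - V s))
          = g s * (π s a * (r s a + γ * ∑ x : S, P s a x * V x)) - g s * V s * π s a := by
        intro a
        have : ∀ x : S, π s a * P s a x * (g s * (r s a + γ * V x - V s))
          = π s a * g s * (r s a - V s) * P s a x + π s a * g s * γ * (P s a x * V x) := by
          intro x; ring
        simp_rw [this, Finset.sum_add_distrib, ← Finset.mul_sum, hPsum]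
        ring
      simp_rw [h2, Finset.sum_sub_distrib, ← Finset.mul_sum, hπsum, ← hV s]
      ring
    | succ k =>
      have hk' : k < N := by omega
      have h : ∀ (a : A) (x : S), (fun τ : Traj S A N => g (st s (consT a x τ) (k + 1))
          * td r γ V s (consT a x τ) (k + 1)) = fun τ => g (st x τ k) * td r γ V x τ k := by
        intro a x
        funext τ
        simp only [td, ac_consT_succ x a τ k hk', st_consT s x a τ k hk'.le,
          st_consT s x a τ (k + 1) hk']
      simp_rw [h, ih _ k hk', mul_zero, Finset.sum_const_zero]

theorem stmt_10 {S A : Type*} [Fintype S] [Fintype A] [Nonempty S] [Nonempty A]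
    (π : S → A → ℝ) (P : S → A → S → ℝ) (r : S → A → ℝ) (γ : ℝ)
    (N : ℕ) (s : S)
    (hπpos : ∀ s₀ a, 0 < π s₀ a) (hπsum : ∀ s₀ : S, ∑ a : A, π s₀ a = 1)
    (hPnn : ∀ s₀ a s', 0 ≤ P s₀ a s') (hPsum : ∀ (s₀ : S) (a : A), ∑ s' : S, P s₀ a s' = 1)
    (hγ0 : 0 ≤ γ) (hγ1 : γ ≤ 1) (hN : 1 ≤ N)
    (V : S → ℝ) (hV : IsBellman π P r γ V)
    (a : A) (k : ℕ) (hk1 : 1 ≤ k) (hk2 : k ≤ N - 1) :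
    vr π P s N (fun τ => pkA π P s N k a (st s τ k) / π s a * td r γ V s τ k)
      = ∑ s' : S, if 0 < pkS π P s N k s' then
          pkSA π P s N k a s' / π s a * pkA π P s N k a s' * sndMom π P r γ V s N k s'
        else 0 := by
  have h0 : expct π P s N
      (fun τ => pkA π P s N k a (st s τ k) / π s a * td r γ V s τ k) = 0 :=
    expct_td π P r γ hπsum hPsum V hV (fun x => pkA π P s N k a x / π s a) N s k (by omega)
  unfold vr
  rw [h0]
  have hR : ∀ s' : S, (if 0 < pkS π P s N k s' then
          pkSA π P s N k a s' / π s a * pkA π P s N k a s' * sndMom π P r γ V s N k s'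
        else 0) = (pkA π P s N k a s' / π s a) ^ 2 *
      ∑ τ : Traj S A N, if st s τ k = s' then trajP π P s N τ * (td r γ V s τ k) ^ 2 else 0 := by
    intro s'
    by_cases h : 0 < pkS π P s N k s'
    · have e : pkA π P s N k a s' =
          prE π P s N (fun τ => ac τ 0 = a ∧ st s τ k = s') / pkS π P s N k s' := by
        unfold pkA
        rw [if_pos h]
      rw [if_pos h, e]
      unfold pkSA sndMom
      have := hπpos s a
      field_simp
    · have e : pkA π P s N k a s' = 0 := by
        unfold pkA
        rw [if_neg h]
      rw [if_neg h, e]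
      simp
  simp_rw [hR, Finset.mul_sum]
  rw [Finset.sum_comm]
  unfold expct
  refine Finset.sum_congr rfl fun τ _ => ?_
  rw [Finset.sum_eq_single (st s τ k)]
  · rw [if_pos rfl]
    ring
  · intro b _ hb
    rw [if_neg (Ne.symm hb), mul_zero]
  · intro h
    exact absurd (Finset.mem_univ _) h

end HCA
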